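/- If there exists a complete uniform nested SQS(v) (all C(v,2) pairs are ND-pairs with common multiplicity (v-2)/6), then there exists a minimum uniform nested SQS(2v), i.e., a nested SQS(2v) with exactly v(v-1) ND-pairs each of multiplicity (2v-1)/3. -/

import Mathlib

open Finset

/-- A nested Steiner quadruple system on a point set `α`: a collection of blocks of
size 4 such that every 3-subset lies in exactly one block, together with a partition
of each block into two pairs (recorded by `pair1` and `pair2`). -/
structure NestedSQS (α : Type*) [DecidableEq α] where
  blocks : Finset (Finset α)
  card4 : ∀ b ∈ blocks, b.card = 4
  cover : ∀ t : Finset α, t.card = 3 → ∃! b, b ∈ blocks ∧ t ⊆ b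
  pair1 : Finset α → Finset α
  pair2 : Finset α → Finset α
  partition : ∀ b ∈ blocks, (pair1 b).card = 2 ∧ (pair2 b).card = 2 ∧
    Disjoint (pair1 b) (pair2 b) ∧ pair1 b ∪ pair2 b = b

variable {α : Type*} [DecidableEq α] [Fintype α]

/-- The multiplicity of a pair `p`: the number of blocks whose partition contains `p`. -/
def NestedSQS.mult (S : NestedSQS α) (p : Finset α) : ℕ :=
  (S.blocks.filter fun b => S.pair1 b = p ∨ S.pair2 b = p).card

/-- The nested design pairs (ND-pairs) of a nested SQS. -/
def NestedSQS.NDpairs (S : NestedSQS α) : Finset (Finset α) :=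
  S.blocks.image S.pair1 ∪ S.blocks.image S.pair2


/-- The slice of a set of points of the doubled design at level `i`. -/
def sl {α : Type*} [DecidableEq α] [Fintype α] (i : Bool) (b : Finset (α × Bool)) : Finset α :=
  Finset.univ.filter fun a => (a, i) ∈ b

/-- The set with slice `A` at level `i` and slice `B` at the other level. -/
def mk2 {α : Type*} [DecidableEq α] [Fintype α] (i : Bool) (A B : Finset α) :
    Finset (α × Bool) :=
  Finset.univ.filter fun x => if x.2 = i then x.1 ∈ A else x.1 ∈ B

section aux
variable {α : Type*} [DecidableEq α] [Fintype α]

lemma mem_sl (i : Bool) (b : Finset (α × Bool)) (a : α) : a ∈ sl i b ↔ (a, i) ∈ b := by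
  simp [sl]

@[simp] lemma sl_mk2 (i : Bool) (A B : Finset α) : sl i (mk2 i A B) = A := by
  ext a; simp [sl, mk2]

@[simp] lemma sl_mk2_not (i : Bool) (A B : Finset α) : sl (!i) (mk2 i A B) = B := by
  ext a; simp [sl, mk2]

lemma sl_ext (i : Bool) {b c : Finset (α × Bool)} (h : sl i b = sl i c)
    (h' : sl (!i) b = sl (!i) c) : b = c := by
  ext ⟨a, j⟩
  rw [← mem_sl, ← mem_sl]
  by_cases hj : j = i
  · rw [hj, h]
  · have : j = !i := by cases i <;> cases j <;> simp_all
    rw [this, h']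

lemma sub_iff (i : Bool) {b c : Finset (α × Bool)} :
    b ⊆ c ↔ sl i b ⊆ sl i c ∧ sl (!i) b ⊆ sl (!i) c := by
  constructor
  · intro h
    refine ⟨fun a ha => ?_, fun a ha => ?_⟩ <;> rw [mem_sl] at * <;> exact h ha
  · rintro ⟨h, h'⟩ ⟨a, j⟩ hx
    rw [← mem_sl] at *
    by_cases hj : j = i
    · subst hj; exact h hx
    · have : j = !i := by cases i <;> cases j <;> simp_all
      subst this; exact h' hx

lemma mk2_sl (i : Bool) (b : Finset (α × Bool)) : mk2 i (sl i b) (sl (!i) b) = b :=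
  sl_ext i (by simp) (by simp)

lemma card_mk2 (i : Bool) (A B : Finset α) : (mk2 i A B).card = A.card + B.card := by
  have : mk2 i A B = A.image (fun a => (a, i)) ∪ B.image (fun a => (a, !i)) := by
    ext ⟨a, j⟩
    cases i <;> cases j <;> simp [mk2]
  rw [this, card_union_of_disjoint, card_image_of_injective, card_image_of_injective]
  · intro a b h; simpa using h
  · intro a b h; simpa using h
  · rw [Finset.disjoint_left]; rintro ⟨a, j⟩; cases i <;> simp <;> aesop

lemma card_sl (i : Bool) (b : Finset (α × Bool)) :
    b.card = (sl i b).card + (sl (!i) b).card := by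
  rw [← card_mk2 i, mk2_sl]

lemma mk2_empty_inj {i j : Bool} {p q : Finset α} (hp : p.Nonempty)
    (h : mk2 i p ∅ = mk2 j q ∅) : i = j ∧ p = q := by
  by_cases hj : j = i
  · subst hj
    have := congrArg (sl j) h
    simpa using this
  · have : j = !i := by cases i <;> cases j <;> simp_all
    subst this
    have := congrArg (sl (!i)) h
    have h2 := congrArg (sl i) h
    have h3 : sl i (mk2 (!i) q ∅) = ∅ := by
      simpa using sl_mk2_not (!i) q ∅
    rw [sl_mk2, h3] at h2
    simp [h2] at hp

end aux

lemma one_factorization (α : Type*) [DecidableEq α] [Fintype α]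
    (n : ℕ) (hn : Fintype.card α = 2 * n + 2) :
    ∃ col : Finset α → ZMod (2 * n + 1), ∀ x k, ∃! p : Finset α,
      p.card = 2 ∧ x ∈ p ∧ col p = k := by
  have hc : Fintype.card α = Fintype.card (Option (ZMod (2 * n + 1))) := by
    rw [Fintype.card_option, ZMod.card, hn]
  let e : α ≃ Option (ZMod (2 * n + 1)) := Fintype.equivOfCardEq hc
  let g : α → ZMod (2 * n + 1) := fun a => (e a).getD 0
  have h0 : (2 : ZMod (2 * n + 1)) * n + 1 = 0 := by
    have := ZMod.natCast_self (2 * n + 1)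
    push_cast at this; exact this
  have h2 : ∀ y z : ZMod (2 * n + 1), 2 * y = z ↔ y = -n * z := by
    intro y z
    constructor
    · rintro rfl; linear_combination (y) * h0
    · rintro rfl; linear_combination (-z) * h0
  let col : Finset α → ZMod (2 * n + 1) := fun p =>
    if e.symm none ∈ p then 2 * ∑ x ∈ p, g x else ∑ x ∈ p, g x
  have key : ∀ x k, ∃! y, y ≠ x ∧ col {x, y} = k := by
    intro x k
    obtain ⟨x, rfl⟩ := e.symm.surjective x
    have c1 : ∀ a b : ZMod (2 * n + 1), a ≠ b →
        col {e.symm (some a), e.symm (some b)} = a + b := by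
      intro a b hab
      have : e.symm (some a) ≠ e.symm (some b) := by simpa using hab
      simp [col, g, sum_pair this]
    have c2 : ∀ a : ZMod (2 * n + 1),
        col {e.symm (some a), e.symm none} = 2 * a := by
      intro a
      have : e.symm (some a) ≠ e.symm none := by simp
      simp [col, g, sum_pair this]
    have c3 : ∀ a : ZMod (2 * n + 1),
        col {e.symm none, e.symm (some a)} = 2 * a := by
      intro a; rw [pair_comm, c2]
    cases x with
    | none =>
      refine ⟨e.symm (some (-n * k)), ⟨by simp, ?_⟩, ?_⟩
      · rw [c3, h2]
      · rintro y ⟨hy, hk⟩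
        obtain ⟨y, rfl⟩ := e.symm.surjective y
        cases y with
        | none => simp at hy
        | some y => rw [c3, h2] at hk; rw [hk]
    | some x =>
      by_cases hx : 2 * x = k
      · refine ⟨e.symm none, ⟨by simp, ?_⟩, ?_⟩
        · rw [c2, hx]
        · rintro y ⟨hy, hk⟩
          obtain ⟨y, rfl⟩ := e.symm.surjective y
          cases y with
          | none => rfl
          | some y =>
            have hxy : y ≠ x := by simpa using hy
            rw [c1 _ _ hxy.symm] at hk
            exact absurd (by linear_combination hk - hx) hxy
      · have hne : k - x ≠ x := fun h => hx (by linear_combination -h)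
        refine ⟨e.symm (some (k - x)), ⟨by simpa using hne, ?_⟩, ?_⟩
        · rw [c1 _ _ hne.symm]; ring
        · rintro y ⟨hy, hk⟩
          obtain ⟨y, rfl⟩ := e.symm.surjective y
          cases y with
          | none => rw [c2] at hk; exact absurd hk hx
          | some y =>
            have hxy : y ≠ x := by simpa using hy
            rw [c1 _ _ hxy.symm] at hk
            rw [← hk]; simp
  refine ⟨col, fun x k => ?_⟩
  obtain ⟨y, ⟨hy, hk⟩, hu⟩ := key x k
  refine ⟨{x, y}, ⟨card_pair hy.symm, by simp, hk⟩, ?_⟩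
  rintro p ⟨hp, hxp, hpk⟩
  obtain ⟨a, b, hab, rfl⟩ := card_eq_two.1 hp
  simp only [mem_insert, mem_singleton] at hxp
  rcases hxp with rfl | rfl
  · rw [hu b ⟨hab.symm, hpk⟩]
  · rw [pair_comm] at hpk ⊢
    rw [hu a ⟨hab, hpk⟩]

section construct
variable {α : Type*} [DecidableEq α] [Fintype α] {K : Type} [DecidableEq K]

/-- Blocks of the doubled design. -/
def Blk (S : NestedSQS α) (col : Finset α → K) (b : Finset (α × Bool)) : Prop :=
  (∃ i, sl i b ∈ S.blocks ∧ sl (!i) b = ∅) ∨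
    ∀ i, (sl i b).card = 2 ∧ col (sl i b) = col (sl (!i) b)

/-- One pair function of the doubled design. -/
def dp (f : Finset α → Finset α) (i : Bool) (b : Finset (α × Bool)) : Finset (α × Bool) :=
  if sl true b = ∅ then mk2 false (f (sl false b)) ∅
  else if sl false b = ∅ then mk2 true (f (sl true b)) ∅
  else mk2 i (sl i b) ∅

lemma dp1 (f : Finset α → Finset α) (i j : Bool) (b : Finset (α × Bool))
    (h : sl j b ≠ ∅) (h' : sl (!j) b = ∅) : dp f i b = mk2 j (f (sl j b)) ∅ := by
  cases j <;> simp at h' <;> simp [dp, h, h']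

lemma dp2 (f : Finset α → Finset α) (i : Bool) (b : Finset (α × Bool))
    (h : ∀ j, (sl j b).card = 2) : dp f i b = mk2 i (sl i b) ∅ := by
  have h' : ∀ j, sl j b ≠ ∅ := fun j hj => by have := h j; simp [hj] at this
  simp [dp, h']

open Classical in
/-- The doubled design. -/
noncomputable def dbl (S : NestedSQS α) (col : Finset α → K)
    (hcol : ∀ x k, ∃! p : Finset α, p.card = 2 ∧ x ∈ p ∧ col p = k) :
    NestedSQS (α × Bool) where
  blocks := Finset.univ.filter (Blk S col)
  card4 := by
    intro b hb
    rcases (mem_filter.1 hb).2 with ⟨i, h, h'⟩ | h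
    · rw [card_sl i, h', S.card4 _ h]; rfl
    · rw [card_sl true, (h _).1, (h _).1]
  cover := by
    intro t ht
    have : ∃ i, 2 ≤ (sl i t).card := by
      by_contra! hcon
      have h1 := hcon true
      have h2 := hcon false
      have h3 := card_sl true t
      simp at h3; omega
    obtain ⟨i, hi⟩ := this
    have hs := card_sl i t
    simp only [mem_filter, mem_univ, true_and]
    by_cases h3 : (sl i t).card = 3
    · have h0 : sl (!i) t = ∅ := by rw [← card_eq_zero]; omega
      obtain ⟨b, ⟨hb, hbt⟩, hu⟩ := S.cover _ h3
      refine ⟨mk2 i b ∅, ⟨Or.inl ⟨i, by simpa using hb, by simp⟩, ?_⟩, ?_⟩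
      · rw [sub_iff i]; simp [hbt, h0]
      · rintro c ⟨hc, htc⟩
        rw [sub_iff i] at htc
        rcases hc with ⟨j, h, h'⟩ | h
        · by_cases hj : j = i
          · subst hj
            apply sl_ext j
            · rw [hu _ ⟨h, htc.1⟩]; simp
            · simp [h']
          · have : i = !j := by cases i <;> cases j <;> simp_all
            rw [← this] at h'
            have := card_le_card htc.1
            rw [h', card_empty] at this; omega
        · have := card_le_card htc.1
          rw [(h i).1] at this; omega
    · have h2 : (sl i t).card = 2 := by omega
      have h1 : (sl (!i) t).card = 1 := by omega
      obtain ⟨x, hx⟩ := card_eq_one.1 h1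
      obtain ⟨p, ⟨hp, hxp, hk⟩, hu⟩ := hcol x (col (sl i t))
      refine ⟨mk2 i (sl i t) p, ⟨Or.inr ?_, ?_⟩, ?_⟩
      · intro j
        by_cases hj : j = i
        · subst hj; simp [h2, hk]
        · have : j = !i := by cases i <;> cases j <;> simp_all
          subst this; simp [hp, hk]
      · rw [sub_iff i]; simp [hx, hxp]
      · rintro c ⟨hc, htc⟩
        rw [sub_iff i] at htc
        rcases hc with ⟨j, h, h'⟩ | h
        · exfalso
          by_cases hj : j = i
          · subst hj
            have := card_le_card htc.2
            simp [h', h1] at this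
          · have : i = !j := by cases i <;> cases j <;> simp_all
            rw [← this] at h'
            have := card_le_card htc.1
            rw [h', card_empty] at this; omega
        · have e1 : sl i t = sl i c := eq_of_subset_of_card_le htc.1 (by rw [(h i).1, h2])
          apply sl_ext i
          · simp [e1]
          · rw [sl_mk2_not]
            refine hu _ ⟨(h _).1, htc.2 (by simp [hx]), ?_⟩
            rw [e1, (h i).2]
  pair1 := dp S.pair1 false
  pair2 := dp S.pair2 true
  partition := by
    intro b hb
    rcases (mem_filter.1 hb).2 with ⟨i, h, h'⟩ | h
    · have hne : sl i b ≠ ∅ := fun h0 => by have := S.card4 _ h; simp [h0] at this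
      rw [dp1 _ _ i b hne h', dp1 _ _ i b hne h', card_mk2, card_mk2]
      obtain ⟨h1, h2, h3, h4⟩ := S.partition _ h
      refine ⟨by simpa, by simpa, ?_, ?_⟩
      · rw [Finset.disjoint_left] at *
        rintro ⟨a, j⟩
        simp only [mk2, mem_filter, mem_univ, true_and]
        split_ifs
        · exact @h3 a
        · simp
      · conv_rhs => rw [← mk2_sl i b, h', ← h4]
        ext ⟨a, j⟩
        by_cases hj : j = i <;> simp [mk2, hj]
    · have h2 := fun i => (h i).1
      rw [dp2 _ _ b h2, dp2 _ _ b h2, card_mk2, card_mk2]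
      refine ⟨by simp [h2], by simp [h2], ?_, ?_⟩
      · rw [Finset.disjoint_left]
        rintro ⟨a, j⟩
        cases j <;> simp [mk2]
      · ext ⟨a, j⟩
        cases j <;> simp [mk2, mem_sl]

end construct

lemma card_factor {α : Type*} [DecidableEq α] [Fintype α] {K : Type} [DecidableEq K]
    (col : Finset α → K)
    (hcol : ∀ x k, ∃! p : Finset α, p.card = 2 ∧ x ∈ p ∧ col p = k) (k : K) :
    2 * (Finset.univ.filter fun p : Finset α => p.card = 2 ∧ col p = k).card
      = Fintype.card α := by
  have := Finset.sum_card (B := Finset.univ.filter fun p : Finset α => p.card = 2 ∧ col p = k)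
    (n := 1) (by
      intro a
      obtain ⟨p, hp, hu⟩ := hcol a k
      rw [card_eq_one]
      refine ⟨p, ?_⟩
      ext q
      simp only [mem_filter, mem_univ, true_and, mem_singleton]
      constructor
      · rintro ⟨⟨h1, h2⟩, h3⟩; exact hu q ⟨h1, h3, h2⟩
      · rintro rfl; exact ⟨⟨hp.1, hp.2.2⟩, hp.2.1⟩)
  rw [Finset.sum_congr rfl (g := fun _ => 2) (by simp +contextual)] at this
  simp at this; omega

lemma dbl_mult {α : Type*} [DecidableEq α] [Fintype α] {K : Type} [DecidableEq K]
    (S : NestedSQS α) (col : Finset α → K)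
    (hcol : ∀ x k, ∃! p : Finset α, p.card = 2 ∧ x ∈ p ∧ col p = k)
    (i : Bool) (p : Finset α) (hp : p.card = 2) :
    (dbl S col hcol).mult (mk2 i p ∅) = S.mult p +
      (Finset.univ.filter fun q : Finset α => q.card = 2 ∧ col q = col p).card := by
  have hpn : p.Nonempty := by rw [← card_pos]; omega
  have hset : ((dbl S col hcol).blocks.filter fun b =>
      (dbl S col hcol).pair1 b = mk2 i p ∅ ∨ (dbl S col hcol).pair2 b = mk2 i p ∅) =
      (S.blocks.filter fun b => S.pair1 b = p ∨ S.pair2 b = p).image (fun b => mk2 i b ∅) ∪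
      (Finset.univ.filter fun q : Finset α => q.card = 2 ∧ col q = col p).image
        (fun q => mk2 i p q) := by
    ext b
    simp only [mem_union, mem_image, mem_filter, mem_univ, true_and]
    simp only [dbl, mem_filter, mem_univ, true_and]
    constructor
    · rintro ⟨⟨j, h, h'⟩ | h, hpair⟩
      · left
        have hne : sl j b ≠ ∅ := fun h0 => by have := S.card4 _ h; simp [h0] at this
        rw [dp1 _ _ j b hne h', dp1 _ _ j b hne h'] at hpair
        have : j = i ∧ (S.pair1 (sl j b) = p ∨ S.pair2 (sl j b) = p) := by
          rcases hpair with hh | hh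
          · have := mk2_empty_inj hpn hh.symm
            exact ⟨this.1.symm, Or.inl this.2.symm⟩
          · have := mk2_empty_inj hpn hh.symm
            exact ⟨this.1.symm, Or.inr this.2.symm⟩
        obtain ⟨rfl, h3⟩ := this
        exact ⟨sl j b, ⟨h, h3⟩, by rw [← h', mk2_sl]⟩
      · right
        have h2 := fun i => (h i).1
        rw [dp2 _ _ b h2, dp2 _ _ b h2] at hpair
        have : p = sl i b := by
          rcases hpair with hh | hh
          · obtain ⟨rfl, h⟩ := mk2_empty_inj hpn hh.symm
            exact h
          · obtain ⟨rfl, h⟩ := mk2_empty_inj hpn hh.symm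
            exact h
        subst this
        exact ⟨sl (!i) b, ⟨h2 _, (h i).2.symm⟩, mk2_sl _ _⟩
    · rintro (⟨c, ⟨hc, h⟩, rfl⟩ | ⟨q, ⟨hq, hk⟩, rfl⟩)
      · have hne : sl i (mk2 i c ∅) ≠ ∅ := fun h0 => by
          have := S.card4 _ hc; simp at h0; simp [h0] at this
        rw [dp1 _ _ i _ hne (by simp), dp1 _ _ i _ hne (by simp)]
        refine ⟨Or.inl ⟨i, by simpa using hc, by simp⟩, ?_⟩
        rw [sl_mk2]
        rcases h with h | h
        · left; rw [h]
        · right; rw [h]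
      · have hB : ∀ j, (sl j (mk2 i p q)).card = 2 ∧
            col (sl j (mk2 i p q)) = col (sl (!j) (mk2 i p q)) := by
          intro j
          by_cases hj : j = i
          · subst hj; simp [hp, hk]
          · have : j = !i := by cases i <;> cases j <;> simp_all
            subst this; simp [hq, hk]
        refine ⟨Or.inr hB, ?_⟩
        rw [dp2 _ _ _ (fun j => (hB j).1), dp2 _ _ _ (fun j => (hB j).1)]
        have := sl_mk2 i p q
        cases i
        · left; rw [this]
        · right; rw [this]
  unfold NestedSQS.mult
  rw [hset, card_union_of_disjoint, card_image_of_injective, card_image_of_injective]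
  · intro a b h
    simpa using congrArg (sl (!i)) h
  · intro a b h
    simpa using congrArg (sl i) h
  · rw [Finset.disjoint_left]
    intro b hb hb'
    simp only [mem_image, mem_filter, mem_univ, true_and] at hb hb'
    obtain ⟨c, -, rfl⟩ := hb
    obtain ⟨q, ⟨hq, -⟩, h⟩ := hb'
    have := congrArg (sl (!i)) h
    simp at this
    simp [this] at hq

lemma dbl_nd {α : Type*} [DecidableEq α] [Fintype α] {K : Type} [DecidableEq K]
    (S : NestedSQS α) (col : Finset α → K)
    (hcol : ∀ x k, ∃! p : Finset α, p.card = 2 ∧ x ∈ p ∧ col p = k)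
    (P : Finset (α × Bool)) :
    P ∈ (dbl S col hcol).NDpairs ↔ ∃ i p, p.card = 2 ∧ P = mk2 i p ∅ := by
  constructor
  · intro h
    simp only [NestedSQS.NDpairs, mem_union, mem_image] at h
    simp only [dbl, mem_filter, mem_univ, true_and] at h
    have aux : ∀ b, Blk S col b → ∀ j, ∀ f : Finset α → Finset α,
        (∀ c ∈ S.blocks, (f c).card = 2) → ∃ i p, p.card = 2 ∧ dp f j b = mk2 i p ∅ := by
      rintro b (⟨i, h, h'⟩ | h) j f hf
      · have hne : sl i b ≠ ∅ := fun h0 => by have := S.card4 _ h; simp [h0] at this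
        exact ⟨i, _, hf _ h, dp1 _ _ i b hne h'⟩
      · exact ⟨j, _, (h j).1, dp2 _ _ b fun i => (h i).1⟩
    rcases h with ⟨b, hb, rfl⟩ | ⟨b, hb, rfl⟩
    · exact aux b hb _ _ fun c hc => (S.partition c hc).1
    · exact aux b hb _ _ fun c hc => (S.partition c hc).2.1
  · rintro ⟨i, p, hp, rfl⟩
    have hm := dbl_mult S col hcol i p hp
    have hpos : 0 < (dbl S col hcol).mult (mk2 i p ∅) := by
      rw [hm]
      apply Nat.add_pos_right
      exact card_pos.2 ⟨p, by simp [hp]⟩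
    unfold NestedSQS.mult at hpos
    obtain ⟨b, hb⟩ := card_pos.1 hpos
    rw [mem_filter] at hb
    simp only [NestedSQS.NDpairs, mem_union, mem_image]
    rcases hb.2 with h | h
    · exact Or.inl ⟨b, hb.1, h⟩
    · exact Or.inr ⟨b, hb.1, h⟩

/-- If there exists a complete uniform nested SQS(v) (all C(v,2) pairs are ND-pairs
with common multiplicity (v-2)/6), then there exists a minimum uniform nested
SQS(2v): one with exactly v(v-1) ND-pairs, each of multiplicity (2v-1)/3. -/
theorem stmt15 (α : Type*) [DecidableEq α] [Fintype α] (hv : 4 ≤ Fintype.card α)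
    (h : ∃ S : NestedSQS α,
      S.NDpairs = Finset.powersetCard 2 (Finset.univ : Finset α) ∧
      ∀ p ∈ S.NDpairs, 6 * S.mult p = Fintype.card α - 2) :
    ∃ T : NestedSQS (α × Bool),
      T.NDpairs.card = Fintype.card α * (Fintype.card α - 1) ∧
      ∀ p ∈ T.NDpairs, 3 * T.mult p = 2 * Fintype.card α - 1 := by
  obtain ⟨S, hS, hm⟩ := h
  have hm' : ∀ p : Finset α, p.card = 2 → 6 * S.mult p = Fintype.card α - 2 := by
    intro p hp
    apply hm
    rw [hS, mem_powersetCard]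
    exact ⟨subset_univ _, hp⟩
  obtain ⟨p0, -, hp0⟩ := Finset.exists_subset_card_eq
    (show 2 ≤ (Finset.univ : Finset α).card by rw [card_univ]; omega)
  have h0 := hm' p0 hp0
  obtain ⟨col, hcol⟩ := one_factorization α (3 * S.mult p0) (by omega)
  refine ⟨dbl S col hcol, ?_, ?_⟩
  · have : (dbl S col hcol).NDpairs =
        ((Finset.univ : Finset Bool) ×ˢ Finset.powersetCard 2 (Finset.univ : Finset α)).image
          (fun x => mk2 x.1 x.2 ∅) := by
      ext P
      rw [dbl_nd]
      simp only [mem_image, mem_product, mem_univ, true_and, mem_powersetCard, subset_univ,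
        Prod.exists]
      constructor
      · rintro ⟨i, p, hp, rfl⟩; exact ⟨i, p, hp, rfl⟩
      · rintro ⟨i, p, hp, rfl⟩; exact ⟨i, p, hp, rfl⟩
    rw [this, card_image_of_injOn, card_product, card_powersetCard, card_univ, card_univ,
      Fintype.card_bool, Nat.choose_two_right, Nat.mul_div_cancel']
    · exact (Nat.even_mul_pred_self _).two_dvd
    · rintro ⟨i, p⟩ hp ⟨j, q⟩ - h
      simp only [coe_product, Set.mem_prod, mem_coe, mem_powersetCard] at hp
      have := mk2_empty_inj (by rw [← card_pos, hp.2.2]; omega) h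
      exact Prod.ext this.1 this.2
  · intro P hP
    obtain ⟨i, p, hp, rfl⟩ := (dbl_nd S col hcol P).1 hP
    rw [dbl_mult S col hcol i p hp]
    have h1 := hm' p hp
    have h2 := card_factor col hcol (col p)
    omega
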